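/- arXiv:2511.11494 — 5 statements merged into one kernel-verified Lean document; each statement's English description precedes it below -/
import Mathlib

section
/- Let N = 2^n with n ≥ 1, ω_N = exp(2πi/N), and fix k with 0 ≤ k ≤ N−1. For each j ∈ {0,…,n−1} let v_j ∈ ℂ² be the vector (1, ω_N^{2^{n−1−j} k}). Then the Kronecker product v_0 ⊗ v_1 ⊗ ⋯ ⊗ v_{n−1} equals the N-dimensional vector whose m-th component is ω_N^{mk} for 0 ≤ m ≤ N−1; consequently (1/√N) · (v_0 ⊗ ⋯ ⊗ v_{n−1}) is the k-th column of the DFT matrix F_N. -/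
open Matrix

/-- The `N`-th root of unity `ω_N = exp(2πi/N)`. -/
noncomputable def omegaN (N : ℕ) : ℂ := Complex.exp (2 * Real.pi * Complex.I / N)

/-- The `N × N` discrete Fourier transform matrix with entries `(F_N)_{jk} = ω_N^{jk} / √N`. -/
noncomputable def Fmat (N : ℕ) : Matrix (Fin N) (Fin N) ℂ :=
  fun j k => omegaN N ^ (j.val * k.val) / (Real.sqrt N : ℂ)

/-- The Kronecker product `v_0 ⊗ v_1 ⊗ ⋯ ⊗ v_{n−1}` of `n` vectors in `ℂ²`, as a vector in
`ℂ^{2^n}`: its component at index `m = Σ_j m_j 2^{n−1−j}` (with binary digits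
`m_j = ⌊m / 2^{n−1−j}⌋ mod 2`, `m_0` most significant) is `∏_j (v_j)_{m_j}`,
in accordance with `(u ⊗ w)_{b·i+j} = u_i w_j`. -/
noncomputable def kronVec (n : ℕ) (v : Fin n → Fin 2 → ℂ) : Fin (2 ^ n) → ℂ :=
  fun m => ∏ j : Fin n,
    v j ⟨m.val / 2 ^ (n - 1 - j.val) % 2, Nat.mod_lt _ (by norm_num)⟩

/-- The `n` lowest binary digits of `m` sum, with weights, to `m % 2 ^ n`. -/
theorem sum_binary_digits (m n : ℕ) :
    ∑ i ∈ Finset.range n, 2 ^ i * (m / 2 ^ i % 2) = m % 2 ^ n := by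
  induction n with
  | zero => simp [Nat.mod_one]
  | succ n ih => rw [Finset.sum_range_succ, ih, Nat.mod_pow_succ]

/-- A Kronecker product of vectors `(1, x ^ 2 ^ (n - 1 - j))` lists the powers of `x`. -/
theorem kronVec_eq_pow (n : ℕ) (x : ℂ) (v : Fin n → Fin 2 → ℂ)
    (hv0 : ∀ j, v j 0 = 1) (hv1 : ∀ j, v j 1 = x ^ 2 ^ (n - 1 - j.val)) (m : Fin (2 ^ n)) :
    kronVec n v m = x ^ m.val := by
  have hv : ∀ j (d : Fin 2), v j d = x ^ (2 ^ (n - 1 - j.val) * d.val) := by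
    intro j d
    fin_cases d
    · simpa using hv0 j
    · simpa using hv1 j
  simp only [kronVec, hv]
  rw [Fin.prod_univ_eq_prod_range
      (fun j => x ^ (2 ^ (n - 1 - j) * (m.val / 2 ^ (n - 1 - j) % 2))) n,
    Finset.prod_range_reflect (fun i => x ^ (2 ^ i * (m.val / 2 ^ i % 2))) n,
    Finset.prod_pow_eq_pow_sum, sum_binary_digits, Nat.mod_eq_of_lt m.isLt]

/-- Let `N = 2^n` with `n ≥ 1`, `ω_N = exp(2πi/N)`, and fix `k` with `0 ≤ k ≤ N−1`.
For `j ∈ {0,…,n−1}` let `v_j = (1, ω_N^{2^{n−1−j} k}) ∈ ℂ²`.  Then the Kronecker product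
`v_0 ⊗ ⋯ ⊗ v_{n−1}` is the vector whose `m`-th component is `ω_N^{mk}`, and consequently
`(1/√N) · (v_0 ⊗ ⋯ ⊗ v_{n−1})` is the `k`-th column of the DFT matrix `F_N`. -/
theorem kron_eq_dft_column (n : ℕ) (hn : 1 ≤ n) (k : Fin (2 ^ n))
    (v : Fin n → Fin 2 → ℂ)
    (hv0 : ∀ j, v j 0 = 1)
    (hv1 : ∀ j, v j 1 = omegaN (2 ^ n) ^ (2 ^ (n - 1 - j.val) * k.val)) :
    ∀ m : Fin (2 ^ n),
      kronVec n v m = omegaN (2 ^ n) ^ (m.val * k.val) ∧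
      (1 / (Real.sqrt (2 ^ n) : ℂ)) * kronVec n v m = Fmat (2 ^ n) m k := by
  intro m
  have h : kronVec n v m = omegaN (2 ^ n) ^ (m.val * k.val) := by
    rw [kronVec_eq_pow n (omegaN (2 ^ n) ^ k.val) v hv0 (fun j => by rw [hv1, ← pow_mul, mul_comm]),
      ← pow_mul, mul_comm]
  refine ⟨h, ?_⟩
  rw [h, Fmat, one_div_mul_eq_div]
  push_cast
  rfl
end

section
/- Let N = 2^n with n ≥ 2, let F_N be the N×N DFT matrix, and let R be the N×(N/2) reflection matrix. Then for all 0 ≤ j ≤ N−1 and 0 ≤ k ≤ N/2−1, the entry (F_N R)_{jk} equals (2i/√N)·sin(2πjk/N). In particular, the product F_N R contains only sine terms. -/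
open Matrix

/-- The `N × (N/2)` reflection matrix for `N = 2^n`: `R_{k,k} = 1` and `R_{N−k,k} = −1` for
`1 ≤ k ≤ N/2 − 1`, all other entries zero (in particular column `0` and rows `0`, `N/2`
are zero).  It implements the antisymmetric extension of a vector of length `N/2`. -/
noncomputable def Rmat (n : ℕ) : Matrix (Fin (2 ^ n)) (Fin (2 ^ (n - 1))) ℂ :=
  fun j k =>
    if k.val ≠ 0 ∧ j.val = k.val then 1
    else if k.val ≠ 0 ∧ j.val = 2 ^ n - k.val then -1
    else 0

theorem omegaN_pow (N m : ℕ) :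
    omegaN N ^ m = Complex.exp ((2 * Real.pi * m / N : ℝ) * Complex.I) := by
  rw [omegaN, ← Complex.exp_nat_mul]
  congr 1
  push_cast
  ring

theorem omegaN_pow_self {N : ℕ} (hN : N ≠ 0) : omegaN N ^ N = 1 :=
  (Complex.isPrimitiveRoot_exp N hN).pow_eq_one

theorem omegaN_pow_mul_sub {N k : ℕ} (hN : N ≠ 0) (hk : k ≤ N) (j : ℕ) :
    omegaN N ^ (j * (N - k)) = (omegaN N ^ (j * k))⁻¹ := by
  apply eq_inv_of_mul_eq_one_left
  rw [← pow_add, ← mul_add, Nat.sub_add_cancel hk, mul_comm, pow_mul, omegaN_pow_self hN,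
    one_pow]

theorem exp_mul_I_sub_inv (x : ℝ) :
    Complex.exp (x * Complex.I) - (Complex.exp (x * Complex.I))⁻¹ =
      2 * Complex.I * Real.sin x := by
  rw [← Complex.exp_neg, ← neg_mul, Complex.exp_mul_I, Complex.exp_mul_I, Complex.cos_neg,
    Complex.sin_neg, Complex.ofReal_sin]
  ring

theorem mul_Rmat_apply_of_eq_zero {ι : Type*} {n : ℕ} (A : Matrix ι (Fin (2 ^ n)) ℂ) (j : ι)
    {k : Fin (2 ^ (n - 1))} (hk : k.val = 0) : (A * Rmat n) j k = 0 := by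
  simp [Matrix.mul_apply, Rmat, hk]

theorem mul_Rmat_apply {ι : Type*} {n : ℕ} (hn : n ≠ 0) (A : Matrix ι (Fin (2 ^ n)) ℂ) (j : ι)
    {k : Fin (2 ^ (n - 1))} (hk : k.val ≠ 0) :
    (A * Rmat n) j k =
      A j ⟨k, k.isLt.trans_le (Nat.pow_le_pow_right two_pos (n.sub_le 1))⟩ -
        A j ⟨2 ^ n - k, Nat.sub_lt (by positivity) (Nat.pos_of_ne_zero hk)⟩ := by
  have hN : 2 ^ n = 2 * 2 ^ (n - 1) := (mul_pow_sub_one hn 2).symm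
  have hR : ∀ x, Rmat n x k =
      (if x = ⟨k, k.isLt.trans_le (Nat.pow_le_pow_right two_pos (n.sub_le 1))⟩ then 1 else 0) -
        (if x = ⟨2 ^ n - k, Nat.sub_lt (by positivity) (Nat.pos_of_ne_zero hk)⟩
          then 1 else 0) := by
    intro x
    have hlt := k.isLt
    simp only [Rmat, Fin.ext_iff, hk, ne_eq, not_false_eq_true, true_and]
    split_ifs
    · omega
    all_goals simp
  simp [Matrix.mul_apply, hR, mul_sub, Finset.sum_sub_distrib]

/-- For `N = 2^n` with `n ≥ 2`, every entry of the product `F_N R` is a pure sine term: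
`(F_N R)_{jk} = (2i/√N) · sin(2πjk/N)`. -/
theorem Fmat_mul_Rmat_entries (n : ℕ) (hn : 2 ≤ n) :
    ∀ (j : Fin (2 ^ n)) (k : Fin (2 ^ (n - 1))),
      (Fmat (2 ^ n) * Rmat n) j k =
        2 * Complex.I / (Real.sqrt (2 ^ n) : ℂ) *
          Real.sin (2 * Real.pi * j.val * k.val / (2 ^ n : ℝ)) := by
  intro j k
  by_cases hk : k.val = 0
  · simp [mul_Rmat_apply_of_eq_zero _ _ hk, hk]
  · have hkN : k.val ≤ 2 ^ n := k.isLt.le.trans (Nat.pow_le_pow_right two_pos (n.sub_le 1))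
    rw [mul_Rmat_apply (by omega) _ _ hk]
    simp only [Fmat]
    rw [omegaN_pow_mul_sub (by positivity) hkN, ← sub_div, omegaN_pow, exp_mul_I_sub_inv]
    push_cast
    rw [← mul_assoc (2 * (Real.pi : ℂ))]
    ring
end

section
/- Let N = 2^n with n ≥ 2, let F_N be the N×N DFT matrix, let R be the N×(N/2) reflection matrix and R̃ = R/√2 its normalisation. Then (R̃ᵀ F_N† R̃)(R̃ᵀ F_N R̃) = J, where J is the (N/2)×(N/2) diagonal matrix with J_{00} = 0 and J_{kk} = 1 for 1 ≤ k ≤ N/2−1. That is, the discrete sine transform composed with its adjoint acts as the identity on all components except component 0. -/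
open Matrix

/-- The normalised reflection matrix `R̃ = R / √2`. -/
noncomputable def Rtil (n : ℕ) : Matrix (Fin (2 ^ n)) (Fin (2 ^ (n - 1))) ℂ :=
  (1 / (Real.sqrt 2 : ℂ)) • Rmat n

theorem isPrimitiveRoot_omegaN (N : ℕ) [NeZero N] : IsPrimitiveRoot (omegaN N) N :=
  Complex.isPrimitiveRoot_exp N (NeZero.ne N)

theorem star_omegaN (N : ℕ) [NeZero N] : star (omegaN N) = (omegaN N)⁻¹ :=
  (Complex.inv_eq_conj
    (Complex.norm_eq_one_of_pow_eq_one (isPrimitiveRoot_omegaN N).pow_eq_one (NeZero.ne N))).symm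

theorem omegaN_pow_neg (N : ℕ) [NeZero N] (j : Fin N) :
    omegaN N ^ (-j).val = (omegaN N ^ j.val)⁻¹ := by
  have h := (isPrimitiveRoot_omegaN N).pow_eq_one
  rw [Fin.val_neg', ← pow_eq_pow_mod _ h, eq_comm]
  refine inv_eq_of_mul_eq_one_left ?_
  rw [← pow_add, Nat.sub_add_cancel j.isLt.le, h]

theorem Fmat_neg_left (N : ℕ) [NeZero N] (j k : Fin N) : Fmat N (-j) k = Fmat N j (-k) := by
  simp only [Fmat]
  rw [pow_mul, omegaN_pow_neg, mul_comm j.val, pow_mul _ (-k).val, omegaN_pow_neg, inv_pow, inv_pow,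
    ← pow_mul, ← pow_mul, mul_comm]

theorem conjTranspose_Fmat_mul_Fmat (N : ℕ) [NeZero N] : (Fmat N)ᴴ * Fmat N = 1 := by
  have hω := isPrimitiveRoot_omegaN N
  have h0 : omegaN N ≠ 0 := hω.ne_zero (NeZero.ne N)
  have hN : (N : ℂ) ≠ 0 := Nat.cast_ne_zero.mpr (NeZero.ne N)
  have hs : (Real.sqrt N : ℂ) * Real.sqrt N = N := by
    rw [← Complex.ofReal_mul, Real.mul_self_sqrt (Nat.cast_nonneg N), Complex.ofReal_natCast]
  ext i k
  set ζ : ℂ := (omegaN N ^ i.val)⁻¹ * omegaN N ^ k.val with hζ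
  have hentry (j : Fin N) : (Fmat N)ᴴ i j * Fmat N j k = ζ ^ j.val / N := by
    have hstar : star (Real.sqrt N : ℂ) = Real.sqrt N := Complex.conj_ofReal _
    rw [conjTranspose_apply, Fmat, Fmat, star_div₀, star_pow, star_omegaN, hstar,
      div_mul_div_comm, hs, hζ, mul_pow, inv_pow, inv_pow, ← pow_mul, ← pow_mul,
      mul_comm i.val, mul_comm k.val]
  rw [mul_apply, Finset.sum_congr rfl fun j _ => hentry j, ← Finset.sum_div,
    Fin.sum_univ_eq_sum_range (fun j => ζ ^ j), one_apply]
  split_ifs with hik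
  · have h1 : ζ = 1 := by rw [hζ, hik, inv_mul_cancel₀ (pow_ne_zero _ h0)]
    simp [h1, hN]
  · have h1 : ζ ≠ 1 := by
      rw [hζ, Ne, inv_mul_eq_one₀ (pow_ne_zero _ h0)]
      exact fun h => hik (Fin.ext (hω.pow_inj i.isLt k.isLt h))
    have hpow : ζ ^ N = 1 := by
      rw [hζ, mul_pow, inv_pow, ← pow_mul, ← pow_mul, mul_comm i.val, mul_comm k.val, pow_mul,
        pow_mul, hω.pow_eq_one, one_pow, one_pow, inv_one, one_mul]
    rw [geom_sum_eq h1, hpow, sub_self, zero_div, zero_div]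

/-- The permutation matrix of the negation `j ↦ -j` modulo `N`. -/
def negMat (N : ℕ) [NeZero N] : Matrix (Fin N) (Fin N) ℂ :=
  (1 : Matrix (Fin N) (Fin N) ℂ).submatrix id (Equiv.neg (Fin N))

theorem negMat_mul_Fmat (N : ℕ) [NeZero N] : negMat N * Fmat N = Fmat N * negMat N := by
  ext j k
  have hj (x : Fin N) : j = -x ↔ x = -j :=
    ⟨fun h => by rw [h, neg_neg], fun h => by rw [h, neg_neg]⟩
  simp [negMat, mul_apply, one_apply, hj, Fmat_neg_left]

theorem negMat_apply (N : ℕ) [NeZero N] (j k : Fin N) :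
    negMat N j k = if j.val + k.val = 0 ∨ j.val + k.val = N then 1 else 0 := by
  have h : j = -k ↔ j.val + k.val = 0 ∨ j.val + k.val = N := by
    rw [Fin.ext_iff, Fin.val_neg]
    simp only [Fin.ext_iff, Fin.val_zero]
    split_ifs <;> omega
  simp only [negMat, submatrix_apply, one_apply, id_eq, Equiv.neg_apply, h]

theorem exists_Rmat_row_eq (n : ℕ) (hn : 1 ≤ n) (j : Fin (2 ^ n)) :
    ∃ (a : Fin (2 ^ (n - 1))) (s : ℂ), (∀ k, Rmat n j k = if k = a then s else 0) ∧
      ((j.val = 0 ∨ j.val = 2 ^ (n - 1)) ∧ s = 0 ∨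
        (0 < j.val ∧ a.val = j.val) ∧ s = 1 ∨
        (0 < a.val ∧ a.val + j.val = 2 ^ n) ∧ s = -1) := by
  have h2 : 2 ^ n = 2 * 2 ^ (n - 1) := by rw [← pow_succ', Nat.sub_add_cancel hn]
  have hpos : 0 < 2 ^ (n - 1) := by positivity
  by_cases hj : j.val = 0 ∨ j.val = 2 ^ (n - 1)
  · refine ⟨⟨0, hpos⟩, 0, fun k => ?_, Or.inl ⟨hj, rfl⟩⟩
    simp only [Rmat, ite_self]
    split_ifs <;> first | omega | rfl
  by_cases hlt : j.val < 2 ^ (n - 1)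
  · refine ⟨⟨j, hlt⟩, 1, fun k => ?_, Or.inr (Or.inl ⟨⟨by omega, rfl⟩, rfl⟩)⟩
    simp only [Rmat, Fin.ext_iff]
    split_ifs <;> first | omega | rfl
  · refine ⟨⟨2 ^ n - j, by omega⟩, -1, fun k => ?_,
      Or.inr (Or.inr ⟨⟨by simp, by simp only; omega⟩, rfl⟩)⟩
    simp only [Rmat, Fin.ext_iff]
    split_ifs <;> first | omega | rfl

theorem Rmat_mul_transpose (n : ℕ) (hn : 1 ≤ n) : Rmat n * (Rmat n)ᵀ = 1 - negMat (2 ^ n) := by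
  have h2 : 2 ^ n = 2 * 2 ^ (n - 1) := by rw [← pow_succ', Nat.sub_add_cancel hn]
  ext i j
  obtain ⟨a, s, ha, hs⟩ := exists_Rmat_row_eq n hn i
  obtain ⟨b, t, hb, ht⟩ := exists_Rmat_row_eq n hn j
  simp only [mul_apply, transpose_apply, ha, hb, ite_mul, zero_mul, Finset.sum_ite_eq',
    Finset.mem_univ, if_true, Matrix.sub_apply, one_apply, negMat_apply]
  simp only [Fin.ext_iff]
  rcases hs with ⟨hs, rfl⟩ | ⟨hs, rfl⟩ | ⟨hs, rfl⟩ <;>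
    rcases ht with ⟨ht, rfl⟩ | ⟨ht, rfl⟩ | ⟨ht, rfl⟩ <;>
    split_ifs <;> first | omega | norm_num

theorem transpose_mul_Rmat (n : ℕ) (hn : 1 ≤ n) :
    (Rmat n)ᵀ * Rmat n =
      (2 : ℂ) • Matrix.diagonal (fun k : Fin (2 ^ (n - 1)) => if k.val = 0 then (0 : ℂ) else 1) := by
  have h2 : 2 ^ n = 2 * 2 ^ (n - 1) := by rw [← pow_succ', Nat.sub_add_cancel hn]
  have hcol (j : Fin (2 ^ n)) (k : Fin (2 ^ (n - 1))) (hk : k.val ≠ 0) : Rmat n j k =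
      (if j = ⟨k, by omega⟩ then 1 else 0) - (if j = ⟨2 ^ n - k, by omega⟩ then 1 else 0) := by
    simp only [Rmat, Fin.ext_iff]
    split_ifs <;> first | omega | simp
  ext k l
  rw [mul_apply, Matrix.smul_apply, diagonal_apply]
  by_cases hk : k.val = 0
  · simp [Rmat, hk]
  by_cases hl : l.val = 0
  · have : k ≠ l := fun h => hk (h ▸ hl)
    simp [Rmat, hl, this]
  simp only [transpose_apply, hcol _ _ hk, hcol _ _ hl, sub_mul, Finset.sum_sub_distrib, ite_mul,
    one_mul, zero_mul, Finset.sum_ite_eq', Finset.mem_univ, if_true, hk, if_false, smul_eq_mul]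
  simp only [Fin.ext_iff]
  split_ifs <;> first | omega | norm_num

/-- For `N = 2^n` with `n ≥ 2`, the discrete sine transform composed with its adjoint acts
as the identity on all components except component `0`:
`(R̃ᵀ F_N† R̃)(R̃ᵀ F_N R̃) = J`, where `J` is diagonal with `J_{00} = 0` and `J_{kk} = 1`
for `1 ≤ k ≤ N/2 − 1`. -/
theorem sine_transform_adjoint_comp (n : ℕ) (hn : 2 ≤ n) :
    ((Rtil n)ᵀ * (Fmat (2 ^ n))ᴴ * Rtil n) * ((Rtil n)ᵀ * Fmat (2 ^ n) * Rtil n) =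
      Matrix.diagonal (fun k : Fin (2 ^ (n - 1)) => if k.val = 0 then (0 : ℂ) else 1) := by
  have hn1 : 1 ≤ n := by omega
  have hs : (1 / (Real.sqrt 2 : ℂ)) * (1 / (Real.sqrt 2 : ℂ)) = 1 / 2 := by
    rw [div_mul_div_comm, ← Complex.ofReal_mul, Real.mul_self_sqrt zero_le_two]
    norm_num
  have hRR : Rtil n * (Rtil n)ᵀ = (1 / 2 : ℂ) • (1 - negMat (2 ^ n)) := by
    rw [Rtil, transpose_smul, Matrix.smul_mul, Matrix.mul_smul, smul_smul, hs, Rmat_mul_transpose n hn1]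
  have hcomm : Rtil n * (Rtil n)ᵀ * Fmat (2 ^ n) = Fmat (2 ^ n) * (Rtil n * (Rtil n)ᵀ) := by
    rw [hRR, Matrix.smul_mul, Matrix.mul_smul, Matrix.sub_mul, Matrix.mul_sub, negMat_mul_Fmat,
      Matrix.one_mul, Matrix.mul_one]
  have hJ : (Rtil n)ᵀ * Rtil n =
      Matrix.diagonal (fun k : Fin (2 ^ (n - 1)) => if k.val = 0 then (0 : ℂ) else 1) := by
    rw [Rtil, transpose_smul, Matrix.smul_mul, Matrix.mul_smul, smul_smul, hs, transpose_mul_Rmat n hn1, smul_smul]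
    norm_num
  calc _ = (Rtil n)ᵀ * (Fmat (2 ^ n))ᴴ * (Rtil n * (Rtil n)ᵀ * Fmat (2 ^ n)) * Rtil n := by
        simp only [Matrix.mul_assoc]
    _ = (Rtil n)ᵀ * ((Fmat (2 ^ n))ᴴ * Fmat (2 ^ n)) * Rtil n * ((Rtil n)ᵀ * Rtil n) := by
        rw [hcomm]
        simp only [Matrix.mul_assoc]
    _ = _ := by
        rw [conjTranspose_Fmat_mul_Fmat, Matrix.mul_one, hJ, diagonal_mul_diagonal]
        congr 1
        ext k
        split_ifs <;> simp
end

section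
/- Let N = 2^n with n ≥ 2, let R be the N×(N/2) reflection matrix and R̃ = R/√2 its normalisation. Let D be an invertible real diagonal (N/2)×(N/2) matrix with diagonal entries d_0, d_1, …, d_{N/2−1}, and let D_E be any invertible real diagonal N×N matrix whose diagonal entries satisfy (D_E)_{kk} = (D_E)_{N−k,N−k} = d_k for 1 ≤ k ≤ N/2−1 (the entries at positions 0 and N/2 being arbitrary nonzero). Then for every antisymmetric vector g ∈ ℂ^N (i.e. g_0 = g_{N/2} = 0 and g_{N−k} = −g_k for 1 ≤ k ≤ N/2−1), one has R̃ D^{−1} R̃ᵀ g = D_E^{−1} g. -/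
open Matrix

/-- Column `k ≠ 0` of the reflection matrix has the two nonzero entries `1` and `-1`, at the
positions `k` and `N - k`. -/
lemma Rmat_transpose_mulVec_apply {n : ℕ} (hn : 2 ≤ n) (g : Fin (2 ^ n) → ℂ)
    (k : Fin (2 ^ (n - 1))) (a b : Fin (2 ^ n)) (hk : k.val ≠ 0) (ha : a.val = k.val)
    (hb : b.val = 2 ^ n - k.val) : ((Rmat n)ᵀ *ᵥ g) k = g a - g b := by
  have hN : 2 ^ n = 2 * 2 ^ (n - 1) := by rw [← pow_succ']; congr 1; omega
  have hkM := k.isLt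
  have hab : a ≠ b := fun h => by have := congrArg Fin.val h; omega
  rw [mulVec, dotProduct, Fintype.sum_eq_add a b hab]
  · have hba : ¬ 2 ^ n - k.val = k.val := by omega
    simp [Rmat, ha, hb, hk, hba, sub_eq_add_neg]
  · rintro j ⟨hja, hjb⟩
    have h₁ : j.val ≠ k.val := fun h => hja (Fin.ext (h.trans ha.symm))
    have h₂ : j.val ≠ 2 ^ n - k.val := fun h => hjb (Fin.ext (h.trans hb.symm))
    simp [Rmat, h₁, h₂]

/-- Rows `0` and `N / 2` of the reflection matrix vanish. -/
lemma Rmat_mulVec_eq_zero {n : ℕ} (hn : 2 ≤ n) (v : Fin (2 ^ (n - 1)) → ℂ) (j : Fin (2 ^ n))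
    (hj : j.val = 0 ∨ j.val = 2 ^ (n - 1)) : (Rmat n *ᵥ v) j = 0 := by
  have hN : 2 ^ n = 2 * 2 ^ (n - 1) := by rw [← pow_succ']; congr 1; omega
  rw [mulVec, dotProduct]
  refine Finset.sum_eq_zero fun k _ => ?_
  have hkM := k.isLt
  have h₁ : ¬ (k.val ≠ 0 ∧ j.val = k.val) := by omega
  have h₂ : ¬ (k.val ≠ 0 ∧ j.val = 2 ^ n - k.val) := by omega
  simp only [Rmat, if_neg h₁, if_neg h₂, zero_mul]

lemma Rmat_mulVec_apply {n : ℕ} (hn : 2 ≤ n) (v : Fin (2 ^ (n - 1)) → ℂ) (j : Fin (2 ^ n))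
    (k : Fin (2 ^ (n - 1))) (hk : k.val ≠ 0) (hj : j.val = k.val) :
    (Rmat n *ᵥ v) j = v k := by
  have hN : 2 ^ n = 2 * 2 ^ (n - 1) := by rw [← pow_succ']; congr 1; omega
  have hkM := k.isLt
  rw [mulVec, dotProduct, Fintype.sum_eq_single k]
  · simp [Rmat, hk, hj]
  · intro l hl
    have hlM := l.isLt
    have hlk : l.val ≠ k.val := Fin.val_ne_of_ne hl
    have h₁ : ¬ (l.val ≠ 0 ∧ j.val = l.val) := by omega
    have h₂ : ¬ (l.val ≠ 0 ∧ j.val = 2 ^ n - l.val) := by omega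
    simp only [Rmat, if_neg h₁, if_neg h₂, zero_mul]

lemma Rmat_mulVec_apply_reflect {n : ℕ} (hn : 2 ≤ n) (v : Fin (2 ^ (n - 1)) → ℂ)
    (j : Fin (2 ^ n)) (k : Fin (2 ^ (n - 1))) (hk : k.val ≠ 0) (hj : j.val = 2 ^ n - k.val) :
    (Rmat n *ᵥ v) j = -v k := by
  have hN : 2 ^ n = 2 * 2 ^ (n - 1) := by rw [← pow_succ']; congr 1; omega
  have hkM := k.isLt
  rw [mulVec, dotProduct, Fintype.sum_eq_single k]
  · have hne : ¬ 2 ^ n - k.val = k.val := by omega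
    simp [Rmat, hk, hj, hne]
  · intro l hl
    have hlM := l.isLt
    have hlk : l.val ≠ k.val := Fin.val_ne_of_ne hl
    have h₁ : ¬ (l.val ≠ 0 ∧ j.val = l.val) := by omega
    have h₂ : ¬ (l.val ≠ 0 ∧ j.val = 2 ^ n - l.val) := by omega
    simp only [Rmat, if_neg h₁, if_neg h₂, zero_mul]

lemma Rtil_mul_mul_transpose (n : ℕ) (A : Matrix (Fin (2 ^ (n - 1))) (Fin (2 ^ (n - 1))) ℂ) :
    Rtil n * A * (Rtil n)ᵀ = (1 / 2 : ℂ) • (Rmat n * A * (Rmat n)ᵀ) := by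
  have hsq : (1 / (Real.sqrt 2 : ℂ)) * (1 / (Real.sqrt 2 : ℂ)) = 1 / 2 := by
    rw [div_mul_div_comm, one_mul, ← Complex.ofReal_mul, Real.mul_self_sqrt zero_le_two,
      Complex.ofReal_ofNat]
  simp only [Rtil, transpose_smul, Matrix.smul_mul, Matrix.mul_smul, smul_smul, hsq]

lemma inv_diagonal_mulVec_apply {ι : Type*} [Fintype ι] [DecidableEq ι] {d : ι → ℝ}
    (hd : ∀ k, d k ≠ 0) (v : ι → ℂ) (k : ι) :
    ((diagonal fun k => (d k : ℂ))⁻¹ *ᵥ v) k = (d k : ℂ)⁻¹ * v k := by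
  have hinv : (diagonal fun k => (d k : ℂ))⁻¹ = diagonal fun k => (d k : ℂ)⁻¹ := by
    refine inv_eq_right_inv ?_
    rw [diagonal_mul_diagonal, ← diagonal_one]
    congr 1
    funext k
    exact mul_inv_cancel₀ (Complex.ofReal_ne_zero.mpr (hd k))
  rw [hinv, mulVec_diagonal]

/-- Let `N = 2^n`, `n ≥ 2`.  Let `D` be an invertible real diagonal `(N/2) × (N/2)` matrix
with diagonal entries `d_k`, and let `D_E` be any invertible real diagonal `N × N` matrix
whose diagonal entries satisfy `(D_E)_{kk} = (D_E)_{N−k,N−k} = d_k` for `1 ≤ k ≤ N/2 − 1`.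
Then for every antisymmetric `g ∈ ℂ^N` (i.e. `g_0 = g_{N/2} = 0` and `g_{N−k} = −g_k` for
`1 ≤ k ≤ N/2 − 1`) one has `R̃ D⁻¹ R̃ᵀ g = D_E⁻¹ g`. -/
theorem half_size_solution_operator (n : ℕ) (hn : 2 ≤ n)
    (d : Fin (2 ^ (n - 1)) → ℝ) (hd : ∀ k, d k ≠ 0)
    (e : Fin (2 ^ n) → ℝ) (he : ∀ j, e j ≠ 0)
    (hde : ∀ (j : Fin (2 ^ n)) (k : Fin (2 ^ (n - 1))), 1 ≤ k.val →
      (j.val = k.val → e j = d k) ∧ (j.val = 2 ^ n - k.val → e j = d k))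
    (g : Fin (2 ^ n) → ℂ)
    (hg0 : ∀ j : Fin (2 ^ n), j.val = 0 → g j = 0)
    (hgmid : ∀ j : Fin (2 ^ n), j.val = 2 ^ (n - 1) → g j = 0)
    (hganti : ∀ (j j' : Fin (2 ^ n)), 1 ≤ j.val → j.val ≤ 2 ^ (n - 1) - 1 →
      j'.val = 2 ^ n - j.val → g j' = - g j) :
    (Rtil n * (Matrix.diagonal (fun k => (d k : ℂ)))⁻¹ * (Rtil n)ᵀ).mulVec g =
      (Matrix.diagonal (fun j => (e j : ℂ)))⁻¹.mulVec g := by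
  have hN : 2 ^ n = 2 * 2 ^ (n - 1) := by rw [← pow_succ']; congr 1; omega
  have hfold : ∀ (k : Fin (2 ^ (n - 1))) (a : Fin (2 ^ n)), k.val ≠ 0 → a.val = k.val →
      ((Rmat n)ᵀ *ᵥ g) k = 2 * g a := by
    intro k a hk ha
    have hkM := k.isLt
    rw [Rmat_transpose_mulVec_apply hn g k a ⟨2 ^ n - k.val, by omega⟩ hk ha rfl,
      hganti a ⟨2 ^ n - k.val, by omega⟩ (by omega) (by omega) (by simp only [ha])]
    ring
  funext j
  have hjN := j.isLt
  rw [Rtil_mul_mul_transpose, smul_mulVec, Pi.smul_apply, smul_eq_mul, ← mulVec_mulVec,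
    ← mulVec_mulVec, inv_diagonal_mulVec_apply he]
  by_cases hj : j.val = 0 ∨ j.val = 2 ^ (n - 1)
  · rw [Rmat_mulVec_eq_zero hn _ j hj, hj.elim (hg0 j) (hgmid j), mul_zero, mul_zero]
  by_cases hlt : j.val < 2 ^ (n - 1)
  · let k : Fin (2 ^ (n - 1)) := ⟨j.val, hlt⟩
    have hk : k.val ≠ 0 := fun h => hj (Or.inl h)
    rw [Rmat_mulVec_apply hn _ j k hk rfl, inv_diagonal_mulVec_apply hd, hfold k j hk rfl,
      (hde j k (Nat.one_le_iff_ne_zero.mpr hk)).1 rfl]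
    ring
  · let k : Fin (2 ^ (n - 1)) := ⟨2 ^ n - j.val, by omega⟩
    let a : Fin (2 ^ n) := ⟨2 ^ n - j.val, by omega⟩
    have hk : k.val ≠ 0 := by simp only [k]; omega
    have hjk : j.val = 2 ^ n - k.val := by simp only [k]; omega
    rw [Rmat_mulVec_apply_reflect hn _ j k hk hjk, inv_diagonal_mulVec_apply hd,
      hfold k a hk rfl, (hde j k (Nat.one_le_iff_ne_zero.mpr hk)).2 hjk,
      hganti a j (Nat.one_le_iff_ne_zero.mpr hk) (by simp only [a]; omega) hjk]
    ring
end

section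
/- Let N = 2m with m ≥ 1, and let U_R be the N×N complex matrix defined by: (U_R)_{0,m} = 1; (U_R)_{m,0} = 1; for each 1 ≤ j ≤ m−1, (U_R)_{j,j} = i/√2, (U_R)_{j,m+j} = 1/√2, (U_R)_{N−j,j} = −i/√2, (U_R)_{N−j,m+j} = 1/√2; and all other entries zero. Then U_R is unitary. -/
open Matrix

/-- The unitary block encoding `U_R` of the antisymmetric reflection, for `N = 2m`:
`(U_R)_{0,m} = 1`, `(U_R)_{m,0} = 1`, and for `1 ≤ j ≤ m − 1`:
`(U_R)_{j,j} = i/√2`, `(U_R)_{j,m+j} = 1/√2`, `(U_R)_{N−j,j} = −i/√2`,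
`(U_R)_{N−j,m+j} = 1/√2`; all other entries are zero. -/
noncomputable def URmat (m : ℕ) : Matrix (Fin (2 * m)) (Fin (2 * m)) ℂ :=
  fun r c =>
    if r.val = 0 ∧ c.val = m then 1
    else if r.val = m ∧ c.val = 0 then 1
    else if 1 ≤ c.val ∧ c.val ≤ m - 1 ∧ r.val = c.val then Complex.I / (Real.sqrt 2 : ℂ)
    else if 1 ≤ c.val ∧ c.val ≤ m - 1 ∧ r.val = 2 * m - c.val then
      -Complex.I / (Real.sqrt 2 : ℂ)
    else if m + 1 ≤ c.val ∧ c.val ≤ m + (m - 1) ∧ r.val = c.val - m then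
      1 / (Real.sqrt 2 : ℂ)
    else if m + 1 ≤ c.val ∧ c.val ≤ m + (m - 1) ∧ r.val = 2 * m - (c.val - m) then
      1 / (Real.sqrt 2 : ℂ)
    else 0

theorem URmat_apply_zero {m : ℕ} (r : Fin (2 * m)) {c : Fin (2 * m)} (hc : c.val = 0) :
    URmat m r c = if r.val = m then 1 else 0 := by
  unfold URmat
  split_ifs <;> first | rfl | omega

theorem URmat_apply_half {m : ℕ} (r : Fin (2 * m)) {c : Fin (2 * m)} (hc : c.val = m) :
    URmat m r c = if r.val = 0 then 1 else 0 := by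
  unfold URmat
  split_ifs <;> first | rfl | omega

theorem URmat_apply_of_lt_half {m : ℕ} (r : Fin (2 * m)) {c : Fin (2 * m)}
    (hc₀ : 1 ≤ c.val) (hc : c.val < m) :
    URmat m r c =
      if r.val = c.val then Complex.I / (Real.sqrt 2 : ℂ)
      else if r.val = 2 * m - c.val then -Complex.I / (Real.sqrt 2 : ℂ) else 0 := by
  unfold URmat
  split_ifs <;> first | rfl | omega

theorem URmat_apply_of_half_lt {m : ℕ} (r : Fin (2 * m)) {c : Fin (2 * m)} (hc : m < c.val) :
    URmat m r c =
      if r.val = c.val - m then 1 / (Real.sqrt 2 : ℂ)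
      else if r.val = 2 * m - (c.val - m) then 1 / (Real.sqrt 2 : ℂ) else 0 := by
  unfold URmat
  split_ifs <;> first | rfl | omega

theorem ofReal_sqrt_two_inv_mul_self :
    ((Real.sqrt 2 : ℝ) : ℂ)⁻¹ * ((Real.sqrt 2 : ℝ) : ℂ)⁻¹ = 2⁻¹ := by
  rw [← mul_inv, ← Complex.ofReal_mul, Real.mul_self_sqrt zero_le_two, Complex.ofReal_ofNat]

/-- For `N = 2m` with `m ≥ 1`, the block encoding `U_R` of the reflection is unitary. -/
theorem URmat_unitary (m : ℕ) (hm : 1 ≤ m) :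
    URmat m ∈ Matrix.unitaryGroup (Fin (2 * m)) ℂ := by
  rw [Matrix.mem_unitaryGroup_iff']
  ext a b
  have ha := a.isLt
  have hb := b.isLt
  simp only [Matrix.star_eq_conjTranspose, Matrix.mul_apply, Matrix.one_apply,
    Matrix.conjTranspose_apply, Fin.ext_iff]
  have hs := ofReal_sqrt_two_inv_mul_self
  have hI := Complex.I_mul_I
  have cases_col (c : Fin (2 * m)) :
      c.val = 0 ∨ c.val = m ∨ (1 ≤ c.val ∧ c.val < m) ∨ m < c.val := by omega
  rcases cases_col a with h | h | h | h
  · simp only [fun r => URmat_apply_zero r h]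
    rw [Fintype.sum_eq_single ⟨m, by omega⟩]
    · rcases cases_col b with h' | h' | h' | h'
      · simp only [URmat_apply_zero _ h']
        split_ifs <;> first | omega | simp
      · simp only [URmat_apply_half _ h']
        split_ifs <;> first | omega | simp
      · simp only [URmat_apply_of_lt_half _ h'.1 h'.2]
        split_ifs <;> first | omega | simp
      · simp only [URmat_apply_of_half_lt _ h']
        split_ifs <;> first | omega | simp
    · intro r hr
      simp only [ne_eq, Fin.ext_iff] at hr
      simp [hr]
  · simp only [fun r => URmat_apply_half r h]
    rw [Fintype.sum_eq_single ⟨0, by omega⟩]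
    · rcases cases_col b with h' | h' | h' | h'
      · simp only [URmat_apply_zero _ h']
        split_ifs <;> first | omega | simp
      · simp only [URmat_apply_half _ h']
        split_ifs <;> first | omega | simp
      · simp only [URmat_apply_of_lt_half _ h'.1 h'.2]
        split_ifs <;> first | omega | simp
      · simp only [URmat_apply_of_half_lt _ h']
        split_ifs <;> first | omega | simp
    · intro r hr
      simp only [ne_eq, Fin.ext_iff] at hr
      simp [hr]
  · simp only [fun r => URmat_apply_of_lt_half r h.1 h.2]
    rw [Fintype.sum_eq_add ⟨a, by omega⟩ ⟨2 * m - a, by omega⟩]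
    · rcases cases_col b with h' | h' | h' | h'
      · simp only [URmat_apply_zero _ h']
        split_ifs <;> first | omega | simp [div_eq_mul_inv]
      · simp only [URmat_apply_half _ h']
        split_ifs <;> first | omega | simp [div_eq_mul_inv]
      · simp only [URmat_apply_of_lt_half _ h'.1 h'.2]
        split_ifs <;>
          first | omega | (simp [div_eq_mul_inv]; done) | (simp [div_eq_mul_inv]; grind)
      · simp only [URmat_apply_of_half_lt _ h']
        split_ifs <;> first | omega | simp [div_eq_mul_inv]
    · simp only [ne_eq, Fin.mk.injEq]
      omega
    · intro r hr
      simp only [ne_eq, Fin.ext_iff] at hr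
      simp [hr]
  · simp only [fun r => URmat_apply_of_half_lt r h]
    rw [Fintype.sum_eq_add ⟨a - m, by omega⟩ ⟨2 * m - (a - m), by omega⟩]
    · rcases cases_col b with h' | h' | h' | h'
      · simp only [URmat_apply_zero _ h']
        split_ifs <;> first | omega | simp [div_eq_mul_inv]
      · simp only [URmat_apply_half _ h']
        split_ifs <;> first | omega | simp [div_eq_mul_inv]
      · simp only [URmat_apply_of_lt_half _ h'.1 h'.2]
        split_ifs <;> first | omega | simp [div_eq_mul_inv]
      · simp only [URmat_apply_of_half_lt _ h']
        split_ifs <;>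
          first | omega | (simp [div_eq_mul_inv]; done) | (simp [div_eq_mul_inv]; grind)
    · simp only [ne_eq, Fin.mk.injEq]
      omega
    · intro r hr
      simp only [ne_eq, Fin.ext_iff] at hr
      simp [hr]
end
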